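/- arXiv:1206.4436 — 3 statements merged into one kernel-verified Lean document; each statement's English description precedes it below -/
import Mathlib

section
/- Let n ≡ 2 (mod 3) and let T ⊆ ℤ^n be a perfect Lee code of radius 1 with 0 ∈ T. Then T contains no codeword of type [3^1], i.e. no element of the form ±3e_i; moreover the number of codewords of type [2^1,1^1] in T equals 2n, and the number of codewords of type [1^3] equals 2n(n-2)/3. -/
/-- `T ⊆ ℤ^n` is a perfect Lee code of radius 1. -/
def PerfectLeeCode (n : ℕ) (T : Set (Fin n → ℤ)) : Prop :=
  ∀ x : Fin n → ℤ, ∃! t, t ∈ T ∧ ∑ i, |x i - t i| ≤ 1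

/-- Type [3^1]: one coordinate equal to ±3, the rest 0. -/
def IsType31 {n : ℕ} (W : Fin n → ℤ) : Prop :=
  ∃ i, |W i| = 3 ∧ ∀ k, k ≠ i → W k = 0

/-- Type [2^1,1^1]: one coordinate ±2, one other coordinate ±1, the rest 0. -/
def IsType2111 {n : ℕ} (W : Fin n → ℤ) : Prop :=
  ∃ i j, i ≠ j ∧ |W i| = 2 ∧ |W j| = 1 ∧ ∀ k, k ≠ i → k ≠ j → W k = 0

/-- Type [1^3]: exactly three coordinates equal to ±1, the rest 0. -/
def IsType13 {n : ℕ} (W : Fin n → ℤ) : Prop :=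
  (∀ k, W k = 0 ∨ |W k| = 1) ∧ (Finset.univ.filter fun k => W k ≠ 0).card = 3

open Finset

/-- The elements of the Lee ball of radius 1 in `ℤ^n`: the origin and the signed unit vectors. -/
def leeBallVec {n : ℕ} : Option (Fin n × ℤˣ) → Fin n → ℤ
  | none => 0
  | some σ => Pi.single σ.1 (σ.2 : ℤ)

theorem sum_abs_le_one_iff {n : ℕ} (x : Fin n → ℤ) :
    ∑ i, |x i| ≤ 1 ↔ ∃ a, x = leeBallVec a := by
  constructor
  · intro h
    by_cases hx : x = 0
    · exact ⟨none, hx⟩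
    · obtain ⟨i, hi⟩ := Function.ne_iff.mp hx
      have hi1 : 1 ≤ |x i| := Int.one_le_abs hi
      have hsum := Finset.add_sum_erase univ (fun k => |x k|) (mem_univ i)
      have hnn : 0 ≤ ∑ k ∈ univ.erase i, |x k| := sum_nonneg fun _ _ => abs_nonneg _
      have hrest : ∑ k ∈ univ.erase i, |x k| = 0 := by omega
      have hunit : IsUnit (x i) := Int.isUnit_iff_abs_eq.mpr (by omega)
      refine ⟨some (i, hunit.unit), funext fun k => ?_⟩
      by_cases hk : k = i
      · subst hk; simp [leeBallVec]
      · have := (sum_eq_zero_iff_of_nonneg (fun _ _ => abs_nonneg _)).mp hrest k (by simp [hk])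
        simpa [leeBallVec, hk] using this
  · rintro ⟨_ | ⟨i, s⟩, rfl⟩
    · simp [leeBallVec]
    · rw [Finset.sum_eq_single i]
      · rcases Int.units_eq_one_or s with rfl | rfl <;> simp [leeBallVec]
      · intro k _ hk; simp [leeBallVec, hk]
      · simp

theorem leeBallVec_injective {n : ℕ} : Function.Injective (leeBallVec (n := n)) := by
  rintro (_ | ⟨i, s⟩) (_ | ⟨j, t⟩) h
  · rfl
  · have := congrFun h j
    exact absurd this (by simp [leeBallVec, eq_comm])
  · have := congrFun h i
    exact absurd this (by simp [leeBallVec])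
  · have hi := congrFun h i
    by_cases hij : i = j
    · subst hij
      simp [leeBallVec] at hi
      rw [Units.ext hi]
    · simp [leeBallVec, hij] at hi

theorem PerfectLeeCode.existsUnique_add_mem {n : ℕ} {T : Set (Fin n → ℤ)}
    (hT : PerfectLeeCode n T) (x : Fin n → ℤ) : ∃! a, x + leeBallVec a ∈ T := by
  have key : ∀ t : Fin n → ℤ, ∑ i, |x i - t i| ≤ 1 ↔ ∃ a, t = x + leeBallVec a := by
    intro t
    have := sum_abs_le_one_iff (t - x)
    simp only [Pi.sub_apply, sub_eq_iff_eq_add'] at this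
    simpa only [abs_sub_comm] using this
  obtain ⟨t, ⟨htT, ht⟩, huniq⟩ := hT x
  obtain ⟨a, rfl⟩ := (key t).mp ht
  exact ⟨a, htT, fun b hb => leeBallVec_injective
    (add_left_cancel (huniq _ ⟨hb, (key _).mpr ⟨b, rfl⟩⟩))⟩

/-- Frobenius for a finite sum of pairwise commuting elements. -/
theorem sum_pow_char_of_commute {ι R : Type*} [Semiring R] (p : ℕ) [Fact p.Prime] [CharP R p]
    (s : Finset ι) (f : ι → R) (hf : ∀ i j, Commute (f i) (f j)) :
    (∑ i ∈ s, f i) ^ p = ∑ i ∈ s, f i ^ p := by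
  classical
  induction s using Finset.induction_on with
  | empty => simp [(Fact.out : p.Prime).ne_zero]
  | insert a s ha ih =>
    rw [sum_insert ha, sum_insert ha, ← ih]
    exact add_pow_char_of_commute p (Commute.sum_right _ _ _ fun i _ => hf a i)

/-- If a function on an abelian group with values in `ZMod p` has constant sum `1` over all
translates of a finite family `v`, then its sums over translates of `p • v` are constant. -/
theorem sum_add_nsmul_eq_card_pow {G ι : Type*} [AddCommGroup G] [Fintype ι] (p : ℕ)
    [Fact p.Prime] (v : ι → G) (f : G → ZMod p) (hf : ∀ x, ∑ a, f (x + v a) = 1) (x : G) :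
    ∑ a, f (x + p • v a) = (Fintype.card ι : ZMod p) ^ (p - 1) := by
  let E : ι → Module.End (ZMod p) (G → ZMod p) :=
    fun a => LinearMap.funLeft (ZMod p) (ZMod p) fun x => x + v a
  have hcomm : ∀ a b, Commute (E a) (E b) := fun a b => by
    ext g x
    simp [E, LinearMap.funLeft_apply, add_right_comm]
  have hpow : ∀ a k g x, (E a ^ k) g x = g (x + k • v a) := by
    intro a k
    induction k with
    | zero => simp
    | succ k ih =>
      intro g x
      rw [pow_succ, Module.End.mul_apply, ih]
      simp [E, LinearMap.funLeft_apply, succ_nsmul, add_assoc]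
  have hone : (∑ a, E a) f = 1 := by
    ext x
    simpa [E, LinearMap.sum_apply, LinearMap.funLeft_apply] using hf x
  have hconst : ∀ k, ((∑ a, E a) ^ k) 1 = fun _ : G => (Fintype.card ι : ZMod p) ^ k := by
    intro k
    induction k with
    | zero => ext; simp
    | succ k ih =>
      ext x
      rw [pow_succ', Module.End.mul_apply, ih]
      simp [E, LinearMap.sum_apply, LinearMap.funLeft_apply, pow_succ']
  have : CharP (Module.End (ZMod p) (G → ZMod p)) p :=
    charP_of_injective_algebraMap (algebraMap (ZMod p) _).injective p
  have hfrob := congrFun (LinearMap.congr_fun (sum_pow_char_of_commute p univ E hcomm) f) x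
  rw [← pow_sub_one_mul (Fact.out : p.Prime).ne_zero, Module.End.mul_apply, hone, hconst] at hfrob
  simpa [LinearMap.sum_apply, hpow] using hfrob.symm

/-- If the translates of a finite family `v` by `T` tile an abelian group, then so do the translates
of `p • v`, for every prime `p` not dividing the size of the family. -/
theorem existsUnique_add_nsmul_mem {G ι : Type*} [AddCommGroup G] [Fintype ι] (p : ℕ)
    [Fact p.Prime] (hp : ¬p ∣ Fintype.card ι) (v : ι → G) (T : Set G)
    (hT : ∀ x, ∃! a, x + v a ∈ T) (x : G) : ∃! a, x + p • v a ∈ T := by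
  classical
  have hcard : ∀ x, #{a | x + v a ∈ T} = 1 := fun x => by
    
    obtain ⟨a, ha, hu⟩ := hT x
    exact card_eq_one.mpr ⟨a, by ext b; simpa using ⟨hu b, fun h => h ▸ ha⟩⟩
  let N : G → ℕ := fun x => #{a | x + p • v a ∈ T}
  have hpos : ∀ x, 1 ≤ N x := by
    intro x
    have h := sum_add_nsmul_eq_card_pow p v (fun y => if y ∈ T then 1 else 0)
      (fun y => by rw [sum_boole, hcard]; simp) x
    rw [sum_boole] at h
    by_contra! h0
    have h0 : N x = 0 := by omega
    simp only [N] at h0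
    rw [h0, Nat.cast_zero] at h
    exact hp ((ZMod.natCast_eq_zero_iff _ _).mp (eq_zero_of_pow_eq_zero h.symm))
  obtain ⟨b, -⟩ := hT x
  have hsum : ∑ _c : ι, 1 = ∑ c, N (x - v b + v c) := by
    simp only [N, card_filter]
    rw [sum_comm]
    refine sum_congr rfl fun a _ => ?_
    rw [← card_filter, ← hcard (x - v b + p • v a)]
    simp only [add_right_comm]
  have h := (sum_eq_sum_iff_of_le fun c _ => hpos (x - v b + v c)).mp hsum b (mem_univ b)
  rw [sub_add_cancel] at h
  obtain ⟨a, ha⟩ := card_eq_one.mp h.symm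
  have hmem : ∀ c, x + p • v c ∈ T ↔ c = a := by simpa [Finset.ext_iff] using ha
  exact ⟨a, (hmem a).mpr rfl, fun c hc => (hmem c).mp hc⟩

section Counting

variable {n : ℕ} {T : Set (Fin n → ℤ)}

theorem leeBallVec_some_apply (σ : Fin n × ℤˣ) (k : Fin n) :
    leeBallVec (some σ) k = if k = σ.1 then (σ.2 : ℤ) else 0 := by
  simp [leeBallVec, Pi.single_apply]

theorem leeBallVec_add_neg (σ : Fin n × ℤˣ) :
    leeBallVec (some σ) + leeBallVec (some (σ.1, -σ.2)) = 0 := by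
  ext k
  by_cases hk : k = σ.1 <;> simp [leeBallVec_some_apply, hk]

theorem eq_or_eq_neg_of_fst_eq {σ ρ : Fin n × ℤˣ} (h : ρ.1 = σ.1) :
    ρ = σ ∨ ρ = (σ.1, -σ.2) := by
  obtain ⟨i, s⟩ := σ
  obtain ⟨j, t⟩ := ρ
  obtain rfl : j = i := h
  rcases Int.units_eq_one_or s with rfl | rfl <;> rcases Int.units_eq_one_or t with rfl | rfl <;>
    simp

theorem PerfectLeeCode.eq_of_add_mem (hT : PerfectLeeCode n T) {x : Fin n → ℤ}
    {a b : Option (Fin n × ℤˣ)} (ha : x + leeBallVec a ∈ T) (hb : x + leeBallVec b ∈ T) : a = b :=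
  (hT.existsUnique_add_mem x).unique ha hb

theorem PerfectLeeCode.leeBallVec_some_notMem (hT : PerfectLeeCode n T) (h0 : 0 ∈ T)
    (σ : Fin n × ℤˣ) : leeBallVec (some σ) ∉ T := fun h =>
  absurd (hT.eq_of_add_mem (x := 0) (a := none) (b := some σ) (by simpa [leeBallVec] using h0)
    (by simpa using h)) (by simp)

theorem PerfectLeeCode.leeBallVec_add_notMem (hT : PerfectLeeCode n T) (h0 : 0 ∈ T)
    {σ τ : Fin n × ℤˣ} (hne : τ ≠ (σ.1, -σ.2)) :
    leeBallVec (some σ) + leeBallVec (some τ) ∉ T := fun h =>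
  hne (Option.some_injective _ (hT.eq_of_add_mem h (by rwa [leeBallVec_add_neg])))

theorem PerfectLeeCode.three_nsmul_notMem (hT : PerfectLeeCode n T) (h0 : 0 ∈ T)
    (hn : n % 3 = 2) (σ : Fin n × ℤˣ) : 3 • leeBallVec (some σ) ∉ T := fun h => by
  have : Fact (Nat.Prime 3) := ⟨Nat.prime_three⟩
  have hcard : ¬3 ∣ Fintype.card (Option (Fin n × ℤˣ)) := by
    simp [Fintype.card_units_int]
    omega
  have := (existsUnique_add_nsmul_mem 3 hcard leeBallVec T hT.existsUnique_add_mem 0).unique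
    (y₁ := none) (y₂ := some σ) (by simpa [leeBallVec] using h0) (by simpa using h)
  simp at this

theorem PerfectLeeCode.existsUnique_two_nsmul_add_mem (hT : PerfectLeeCode n T) (h0 : 0 ∈ T)
    (hn : n % 3 = 2) (σ : Fin n × ℤˣ) :
    ∃! τ : Fin n × ℤˣ, σ.1 ≠ τ.1 ∧ 2 • leeBallVec (some σ) + leeBallVec (some τ) ∈ T := by
  obtain ⟨_ | τ, ha, hu⟩ := hT.existsUnique_add_mem (2 • leeBallVec (some σ))
  · refine absurd ha ?_
    have := hT.leeBallVec_add_notMem h0 (σ := σ) (τ := σ)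
      (by rcases Int.units_eq_one_or σ.2 with h | h <;> simp [Prod.ext_iff, h])
    rwa [two_nsmul, leeBallVec, add_zero]
  · refine ⟨τ, ⟨fun h => ?_, ha⟩, fun ρ hρ => Option.some_injective _ (hu _ hρ.2)⟩
    rcases eq_or_eq_neg_of_fst_eq h.symm with rfl | rfl
    · exact hT.three_nsmul_notMem h0 hn τ (by rwa [succ_nsmul])
    · rw [two_nsmul, add_assoc, leeBallVec_add_neg, add_zero] at ha
      exact hT.leeBallVec_some_notMem h0 σ ha

theorem isType31_iff {W : Fin n → ℤ} :
    IsType31 W ↔ ∃ σ : Fin n × ℤˣ, W = 3 • leeBallVec (some σ) := by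
  constructor
  · rintro ⟨i, hi, hrest⟩
    rcases eq_or_eq_neg_of_abs_eq hi with hi | hi
    · refine ⟨(i, 1), funext fun k => ?_⟩
      by_cases hk : k = i
      · subst hk; simp [leeBallVec_some_apply, hi]
      · simp [leeBallVec_some_apply, hk, hrest k hk]
    · refine ⟨(i, -1), funext fun k => ?_⟩
      by_cases hk : k = i
      · subst hk; simp [leeBallVec_some_apply, hi]
      · simp [leeBallVec_some_apply, hk, hrest k hk]
  · rintro ⟨⟨i, s⟩, rfl⟩
    refine ⟨i, ?_, fun k hk => by simp [leeBallVec_some_apply, hk]⟩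
    rcases Int.units_eq_one_or s with rfl | rfl <;> simp [leeBallVec_some_apply]

theorem isType2111_iff {W : Fin n → ℤ} :
    IsType2111 W ↔ ∃ σ τ : Fin n × ℤˣ, σ.1 ≠ τ.1 ∧
      W = 2 • leeBallVec (some σ) + leeBallVec (some τ) := by
  constructor
  · rintro ⟨i, j, hij, hi, hj, hrest⟩
    have hs : ∃ s : ℤˣ, W i = 2 * s := by
      rcases eq_or_eq_neg_of_abs_eq hi with hi | hi
      · exact ⟨1, by simp [hi]⟩
      · exact ⟨-1, by simp [hi]⟩
    obtain ⟨s, hs⟩ := hs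
    refine ⟨(i, s), (j, (Int.isUnit_iff_abs_eq.mpr hj).unit), hij, funext fun k => ?_⟩
    by_cases hki : k = i
    · subst hki
      simp [leeBallVec_some_apply, hij, hs]
    · by_cases hkj : k = j
      · subst hkj
        simp [leeBallVec_some_apply, hki]
      · simp [leeBallVec_some_apply, hki, hkj, hrest k hki hkj]
  · rintro ⟨⟨i, s⟩, ⟨j, t⟩, hij, rfl⟩
    change i ≠ j at hij
    refine ⟨i, j, hij, ?_, ?_, fun k hki hkj => by simp [leeBallVec_some_apply, hki, hkj]⟩
    · rcases Int.units_eq_one_or s with rfl | rfl <;> simp [leeBallVec_some_apply, hij]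
    · rcases Int.units_eq_one_or t with rfl | rfl <;> simp [leeBallVec_some_apply, hij.symm]

theorem two_nsmul_add_leeBallVec_injOn :
    Set.InjOn (fun p : (Fin n × ℤˣ) × (Fin n × ℤˣ) =>
      2 • leeBallVec (some p.1) + leeBallVec (some p.2)) {p | p.1.1 ≠ p.2.1} := by
  rintro ⟨⟨i, s⟩, ⟨j, t⟩⟩ hp ⟨⟨i', s'⟩, ⟨j', t'⟩⟩ hp' h
  change i ≠ j at hp
  change i' ≠ j' at hp'
  have hi := congrFun h i
  have hj := congrFun h j
  simp only [Pi.add_apply, Pi.smul_apply, leeBallVec_some_apply, if_neg hp, if_neg hp.symm,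
    if_true] at hi hj
  clear h
  rcases Int.units_eq_one_or s with rfl | rfl <;> rcases Int.units_eq_one_or t with rfl | rfl <;>
  rcases Int.units_eq_one_or s' with rfl | rfl <;> rcases Int.units_eq_one_or t' with rfl | rfl <;>
    simp only [Units.val_neg, Units.val_one, Prod.mk.injEq] at hi hj ⊢ <;> grind

theorem isType13_and_apply_eq_iff {W : Fin n → ℤ} {σ τ : Fin n × ℤˣ} (hστ : σ.1 ≠ τ.1) :
    (IsType13 W ∧ W σ.1 = σ.2 ∧ W τ.1 = τ.2) ↔
      ∃ ρ : Fin n × ℤˣ, ρ.1 ≠ σ.1 ∧ ρ.1 ≠ τ.1 ∧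
        W = leeBallVec (some σ) + leeBallVec (some τ) + leeBallVec (some ρ) := by
  constructor
  · rintro ⟨⟨hW, hcard⟩, hσ, hτ⟩
    have h1 : #(((univ.filter fun k => W k ≠ 0).erase σ.1).erase τ.1) = 1 := by
      rw [card_erase_of_mem (by simp [hστ.symm, hτ]), card_erase_of_mem (by simp [hσ]), hcard]
    obtain ⟨k, hk⟩ := card_eq_one.mp h1
    have hmem : ∀ l, (l ≠ τ.1 ∧ l ≠ σ.1 ∧ W l ≠ 0) ↔ l = k := by simpa [Finset.ext_iff] using hk
    obtain ⟨hkτ, hkσ, hk0⟩ := (hmem k).mpr rfl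
    refine ⟨(k, (Int.isUnit_iff_abs_eq.mpr ((hW k).resolve_left hk0)).unit), hkσ, hkτ,
      funext fun l => ?_⟩
    by_cases hlσ : l = σ.1
    · subst hlσ; simp [leeBallVec_some_apply, hστ, hkσ.symm, hσ]
    · by_cases hlτ : l = τ.1
      · subst hlτ; simp [leeBallVec_some_apply, hστ.symm, hkτ.symm, hτ]
      · by_cases hlk : l = k
        · subst hlk; simp [leeBallVec_some_apply, hlσ, hlτ]
        · have : W l = 0 := by
            by_contra h
            exact hlk ((hmem l).mp ⟨hlτ, hlσ, h⟩)
          simp [leeBallVec_some_apply, hlσ, hlτ, hlk, this]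
  · rintro ⟨ρ, hρσ, hρτ, rfl⟩
    refine ⟨⟨fun k => ?_, ?_⟩, ?_, ?_⟩
    · have habs : ∀ s : ℤˣ, |(s : ℤ)| = 1 := fun s => Int.isUnit_iff_abs_eq.mp s.isUnit
      by_cases hkσ : k = σ.1
      · simp [leeBallVec_some_apply, hkσ, hστ, hρσ.symm, habs]
      · by_cases hkτ : k = τ.1
        · simp [leeBallVec_some_apply, hkτ, hστ.symm, hρτ.symm, habs]
        · by_cases hkρ : k = ρ.1
          · simp [leeBallVec_some_apply, hkρ, hρσ, hρτ, habs]
          · simp [leeBallVec_some_apply, hkσ, hkτ, hkρ]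
    · rw [card_eq_three]
      refine ⟨σ.1, τ.1, ρ.1, hστ, hρσ.symm, hρτ.symm, ?_⟩
      ext k
      by_cases hkσ : k = σ.1
      · simp [leeBallVec_some_apply, hkσ, hστ, hρσ.symm]
      · by_cases hkτ : k = τ.1
        · simp [leeBallVec_some_apply, hkτ, hστ.symm, hρτ.symm]
        · simp [leeBallVec_some_apply, hkσ, hkτ]
    · simp [leeBallVec_some_apply, hστ, hρσ.symm]
    · simp [leeBallVec_some_apply, hστ.symm, hρτ.symm]

theorem IsType13.card_pairs {W : Fin n → ℤ} (hW : IsType13 W) :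
    #{p : (Fin n × ℤˣ) × (Fin n × ℤˣ) | p.1.1 ≠ p.2.1 ∧ W p.1.1 = p.1.2 ∧ W p.2.1 = p.2.2} = 6 := by
  have hoff : #(univ.filter fun k => W k ≠ 0).offDiag = 6 := by rw [offDiag_card, hW.2]
  rw [← hoff]
  refine card_bij (fun p _ => (p.1.1, p.2.1)) ?_ ?_ ?_
  · rintro ⟨⟨i, s⟩, ⟨j, t⟩⟩ hp
    simp only [mem_filter, mem_univ, true_and] at hp
    simp [hp]
  · rintro ⟨⟨i, s⟩, ⟨j, t⟩⟩ hp ⟨⟨i', s'⟩, ⟨j', t'⟩⟩ hp' h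
    simp only [mem_filter, mem_univ, true_and] at hp hp'
    obtain ⟨rfl, rfl⟩ := Prod.mk.inj h
    rw [Units.ext (hp.2.1.symm.trans hp'.2.1), Units.ext (hp.2.2.symm.trans hp'.2.2)]
  · rintro ⟨i, j⟩ hij
    simp only [mem_offDiag, mem_filter, mem_univ, true_and] at hij
    have hu : ∀ k, W k ≠ 0 → IsUnit (W k) := fun k hk =>
      Int.isUnit_iff_abs_eq.mpr ((hW.1 k).resolve_left hk)
    exact ⟨((i, (hu i hij.1).unit), (j, (hu j hij.2.1).unit)), by simpa using hij.2.2, rfl⟩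

theorem card_pairs_fst_ne :
    #{p : (Fin n × ℤˣ) × (Fin n × ℤˣ) | p.1.1 ≠ p.2.1} = 2 * n * (2 * (n - 1)) := by
  have h : ∀ σ : Fin n × ℤˣ, #{τ : Fin n × ℤˣ | σ.1 ≠ τ.1} = 2 * (n - 1) := by
    intro σ
    have : ({τ : Fin n × ℤˣ | σ.1 ≠ τ.1} : Finset _) = univ.erase σ.1 ×ˢ univ := by
      ext τ
      simp only [mem_filter, mem_product, mem_erase, mem_univ, true_and, and_true, ne_comm]
    rw [this, card_product]
    simp [mul_comm]
  rw [card_filter, Fintype.sum_prod_type]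
  simp only [← card_filter, h]
  simp [Fintype.card_units_int, mul_comm n]

theorem PerfectLeeCode.card_pairs_two_nsmul_add_mem [DecidablePred (· ∈ T)]
    (hT : PerfectLeeCode n T) (h0 : 0 ∈ T) (hn : n % 3 = 2) :
    #{p : (Fin n × ℤˣ) × (Fin n × ℤˣ) | p.1.1 ≠ p.2.1 ∧
      2 • leeBallVec (some p.1) + leeBallVec (some p.2) ∈ T} = 2 * n := by
  have h : ∀ σ : Fin n × ℤˣ, #{τ : Fin n × ℤˣ | σ.1 ≠ τ.1 ∧
      2 • leeBallVec (some σ) + leeBallVec (some τ) ∈ T} = 1 := by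
    intro σ
    obtain ⟨τ, hτ, hu⟩ := hT.existsUnique_two_nsmul_add_mem h0 hn σ
    refine card_eq_one.mpr ⟨τ, ?_⟩
    ext ρ
    rw [mem_filter, mem_singleton]
    exact ⟨fun h => hu ρ h.2, fun h => h ▸ ⟨mem_univ _, hτ⟩⟩
  rw [card_filter, Fintype.sum_prod_type]
  simp only [← card_filter, h]
  simp [Fintype.card_units_int, mul_comm n]

/-- A word `e_σ + e_τ` with two nonzero coordinates is covered by exactly one codeword, which is
`2e_σ + e_τ`, `2e_τ + e_σ`, or a codeword with three nonzero coordinates. -/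
theorem PerfectLeeCode.card_cover_pair [DecidablePred (· ∈ T)] (hT : PerfectLeeCode n T)
    (h0 : 0 ∈ T) (A : Finset (Fin n → ℤ)) (hA : ∀ W, W ∈ A ↔ W ∈ T ∧ IsType13 W)
    {σ τ : Fin n × ℤˣ} (hστ : σ.1 ≠ τ.1) :
    (if 2 • leeBallVec (some σ) + leeBallVec (some τ) ∈ T then 1 else 0) +
      (if 2 • leeBallVec (some τ) + leeBallVec (some σ) ∈ T then 1 else 0) +
      #{W ∈ A | W σ.1 = (σ.2 : ℤ) ∧ W τ.1 = (τ.2 : ℤ)} = 1 := by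
  have hmem : ∀ W, W ∈ A.filter (fun W => W σ.1 = (σ.2 : ℤ) ∧ W τ.1 = (τ.2 : ℤ)) ↔
      W ∈ T ∧ ∃ ρ : Fin n × ℤˣ, ρ.1 ≠ σ.1 ∧ ρ.1 ≠ τ.1 ∧
        W = leeBallVec (some σ) + leeBallVec (some τ) + leeBallVec (some ρ) := fun W => by
    rw [mem_filter, hA, and_assoc, isType13_and_apply_eq_iff hστ]
  obtain ⟨a, ha, hu⟩ := hT.existsUnique_add_mem (leeBallVec (some σ) + leeBallVec (some τ))
  have hne : σ ≠ τ := fun h => hστ (congrArg Prod.fst h)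
  have e1 : 2 • leeBallVec (some σ) + leeBallVec (some τ) =
      leeBallVec (some σ) + leeBallVec (some τ) + leeBallVec (some σ) := by
    rw [two_nsmul, add_right_comm]
  have e2 : 2 • leeBallVec (some τ) + leeBallVec (some σ) =
      leeBallVec (some σ) + leeBallVec (some τ) + leeBallVec (some τ) := by
    rw [two_nsmul, add_comm, add_assoc]
  have hiff : ∀ b, leeBallVec (some σ) + leeBallVec (some τ) + leeBallVec b ∈ T ↔ b = a :=
    fun b => ⟨hu b, fun h => h ▸ ha⟩
  rw [e1, e2]
  simp only [hiff]
  obtain _ | ρ := a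
  · exact absurd ha (by
      simpa [leeBallVec] using hT.leeBallVec_add_notMem h0 (σ := σ) (τ := τ)
        (fun h => hστ (congrArg Prod.fst h).symm))
  simp only [Option.some_inj] at hiff ⊢
  by_cases hρ : ρ.1 ≠ σ.1 ∧ ρ.1 ≠ τ.1
  · have hs : A.filter (fun W => W σ.1 = (σ.2 : ℤ) ∧ W τ.1 = (τ.2 : ℤ)) =
        {leeBallVec (some σ) + leeBallVec (some τ) + leeBallVec (some ρ)} := by
      ext W
      rw [hmem, mem_singleton]
      constructor
      · rintro ⟨hW, ρ', -, -, rfl⟩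
        rw [Option.some_injective _ (hu _ hW)]
      · rintro rfl
        exact ⟨ha, ρ, hρ.1, hρ.2, rfl⟩
    rw [hs, if_neg (fun h => hρ.1 (congrArg Prod.fst h).symm),
      if_neg (fun h => hρ.2 (congrArg Prod.fst h).symm), card_singleton]
  · have hs : A.filter (fun W => W σ.1 = (σ.2 : ℤ) ∧ W τ.1 = (τ.2 : ℤ)) = ∅ := by
      refine eq_empty_of_forall_notMem fun W hW => ?_
      obtain ⟨hWT, ρ', h1, h2, rfl⟩ := (hmem W).mp hW
      rw [Option.some_injective _ (hu _ hWT)] at h1 h2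
      exact hρ ⟨h1, h2⟩
    have hcase : ρ = σ ∨ ρ = τ := by
      by_cases h : ρ.1 = σ.1
      · refine Or.inl ((eq_or_eq_neg_of_fst_eq h).resolve_right fun h' => ?_)
        rw [h', add_right_comm, leeBallVec_add_neg, zero_add] at ha
        exact hT.leeBallVec_some_notMem h0 τ ha
      · refine Or.inr ((eq_or_eq_neg_of_fst_eq (by tauto)).resolve_right fun h' => ?_)
        rw [h', add_assoc, leeBallVec_add_neg, add_zero] at ha
        exact hT.leeBallVec_some_notMem h0 σ ha
    rw [hs]
    rcases hcase with rfl | rfl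
    · simp [hne.symm]
    · simp [hne]

theorem PerfectLeeCode.card_isType13 (hT : PerfectLeeCode n T) (h0 : 0 ∈ T) (hn : n % 3 = 2)
    (A : Finset (Fin n → ℤ)) (hA : ∀ W, W ∈ A ↔ W ∈ T ∧ IsType13 W) :
    2 * n + 2 * n + 6 * #A = 2 * n * (2 * (n - 1)) := by
  classical
  have hswap : #{p : (Fin n × ℤˣ) × (Fin n × ℤˣ) | p.1.1 ≠ p.2.1 ∧
      2 • leeBallVec (some p.2) + leeBallVec (some p.1) ∈ T} = 2 * n := by
    rw [← hT.card_pairs_two_nsmul_add_mem h0 hn]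
    refine card_bij (fun p _ => p.swap) ?_ (fun _ _ _ _ h => Prod.swap_injective h) ?_
    · intro p hp
      simpa [eq_comm] using hp
    · intro p hp
      exact ⟨p.swap, by simpa [eq_comm] using hp, Prod.swap_swap p⟩
  have hcover := sum_congr (rfl : ({p : (Fin n × ℤˣ) × (Fin n × ℤˣ) | p.1.1 ≠ p.2.1} : Finset _) = _)
    fun p hp => hT.card_cover_pair h0 A hA (mem_filter.mp hp).2
  have hdouble : ∑ p : (Fin n × ℤˣ) × (Fin n × ℤˣ) with p.1.1 ≠ p.2.1,
      #{W ∈ A | W p.1.1 = (p.1.2 : ℤ) ∧ W p.2.1 = (p.2.2 : ℤ)} = 6 * #A := by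
    simp only [card_filter]
    rw [sum_comm, mul_comm, ← smul_eq_mul, ← sum_const]
    refine sum_congr rfl fun W hW => ?_
    rw [← card_filter, filter_filter, ((hA W).mp hW).2.card_pairs]
  rw [sum_add_distrib, sum_add_distrib, hdouble, ← card_filter, ← card_filter, filter_filter,
    filter_filter, hT.card_pairs_two_nsmul_add_mem h0 hn, hswap, sum_const, card_pairs_fst_ne,
    smul_eq_mul, mul_one] at hcover
  exact hcover

end Counting

/-- For `n ≡ 2 (mod 3)`: there are no codewords of type [3^1], exactly `2n` of
type [2^1,1^1], and `2n(n-2)/3` of type [1^3]. -/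
theorem counts_mod_three (n : ℕ) (hn : n % 3 = 2) (T : Set (Fin n → ℤ))
    (hT : PerfectLeeCode n T) (h0 : 0 ∈ T) :
    (∀ W ∈ T, ¬IsType31 W) ∧
    {W ∈ T | IsType2111 W}.ncard = 2 * n ∧
    {W ∈ T | IsType13 W}.ncard = 2 * n * (n - 2) / 3 := by
  classical
  refine ⟨fun W hW h => ?_, ?_, ?_⟩
  · obtain ⟨σ, rfl⟩ := isType31_iff.mp h
    exact hT.three_nsmul_notMem h0 hn σ hW
  · have himage : {W ∈ T | IsType2111 W} =
        (fun p : (Fin n × ℤˣ) × (Fin n × ℤˣ) =>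
          2 • leeBallVec (some p.1) + leeBallVec (some p.2)) ''
        (({p | p.1.1 ≠ p.2.1 ∧ 2 • leeBallVec (some p.1) + leeBallVec (some p.2) ∈ T} :
          Finset ((Fin n × ℤˣ) × (Fin n × ℤˣ))) : Set ((Fin n × ℤˣ) × (Fin n × ℤˣ))) := by
      ext W
      simp only [Set.mem_ofPred_eq, Set.mem_image, mem_coe, mem_filter, mem_univ, true_and,
        isType2111_iff]
      constructor
      · rintro ⟨hW, σ, τ, hne, rfl⟩
        exact ⟨(σ, τ), ⟨hne, hW⟩, rfl⟩
      · rintro ⟨⟨σ, τ⟩, ⟨hne, hW⟩, rfl⟩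
        exact ⟨hW, σ, τ, hne, rfl⟩
    rw [himage, (two_nsmul_add_leeBallVec_injOn.mono fun p hp =>
      (mem_filter.mp (mem_coe.mp hp)).2.1).ncard_image, Set.ncard_coe_finset,
      hT.card_pairs_two_nsmul_add_mem h0 hn]
  · have hfin : {W ∈ T | IsType13 W}.Finite := by
      refine (Fintype.piFinset fun _ : Fin n => Finset.Icc (-1 : ℤ) 1).finite_toSet.subset ?_
      rintro W ⟨-, hW, -⟩
      simp only [mem_coe, Fintype.mem_piFinset, mem_Icc, ← abs_le]
      intro k
      rcases hW k with h | h <;> simp [h]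
    have h := hT.card_isType13 h0 hn hfin.toFinset (by simp)
    rw [Set.ncard_eq_toFinset_card _ hfin]
    obtain ⟨m, rfl⟩ : ∃ m, n = m + 2 := ⟨n - 2, by omega⟩
    have hN : 2 * (m + 2) * (m + 2 - 2) = 3 * #hfin.toFinset := by
      simp only [Nat.add_sub_cancel, show m + 2 - 1 = m + 1 by omega] at h ⊢
      linarith
    rw [hN, Nat.mul_div_cancel_left _ (by norm_num)]
end

section
/- Let n ≡ 2 (mod 3) and let T ⊆ ℤ^n be a perfect Lee code of radius 1 with 0 ∈ T. For each signed coordinate direction (i, ε) with 1 ≤ i ≤ n and ε ∈ {+1, -1}, there is exactly one codeword W ∈ T of type [2^1,1^1] with W_i = 2ε, and exactly one codeword W of type [2^1,1^1] with W_i = ε. -/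
section Tiling

variable {V ι : Type*} [AddCommGroup V] [Fintype ι]

/-- The translation operators on functions `V → R`, as a multiplicative homomorphism. -/
def translation (R V : Type*) [CommRing R] [AddCommGroup V] :
    Multiplicative V →* Module.End R (V → R) where
  toFun v := LinearMap.funLeft R R fun x => x - v.toAdd
  map_one' := by ext f x; simp [LinearMap.funLeft_apply]
  map_mul' v w := by
    ext1 f
    funext x
    simp [LinearMap.funLeft_apply, sub_sub]

/-- Frobenius for sums of translations in characteristic `p`: a function whose translates by
the `v a` add up to `1` has translates by the `p • v a` adding up to `1`, provided that `p` does
not divide the number of translates. -/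
theorem sum_translates_nsmul_eq_one {p : ℕ} [hp : Fact p.Prime] (v : ι → V)
    (hcard : ¬ p ∣ Fintype.card ι) (f : V → ZMod p)
    (hf : ∀ x, ∑ a, f (x - v a) = 1) (x : V) : ∑ a, f (x - p • v a) = 1 := by
  let Φ := AddMonoidAlgebra.lift (ZMod p) (Module.End (ZMod p) (V → ZMod p)) V
    (translation (ZMod p) V)
  let M : AddMonoidAlgebra (ZMod p) V := ∑ a, AddMonoidAlgebra.single (v a) 1
  have hΦ (w : ι → V) (g : V → ZMod p) (y : V) :
      Φ (∑ a, AddMonoidAlgebra.single (w a) 1) g y = ∑ a, g (y - w a) := by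
    simp [Φ, translation, LinearMap.funLeft_apply]
  have hMf : Φ M f = fun _ => 1 := funext fun y => (hΦ v f y).trans (hf y)
  have hMconst (k : ℕ) :
      (Φ M ^ k) (fun _ => 1) = fun _ => (Fintype.card ι : ZMod p) ^ k := by
    induction k with
    | zero => simp
    | succ k ih =>
      funext y
      rw [pow_succ', Module.End.mul_apply, ih]
      refine (hΦ v _ y).trans ?_
      simp [pow_succ']
  have : CharP (AddMonoidAlgebra (ZMod p) V) p :=
    charP_of_injective_algebraMap (algebraMap (ZMod p) _).injective p
  have hMpow : M ^ p = ∑ a, AddMonoidAlgebra.single (p • v a) 1 := by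
    simp [M, sum_pow_char, AddMonoidAlgebra.single_pow]
  have hcard' : (Fintype.card ι : ZMod p) ≠ 0 := by
    rwa [Ne, ZMod.natCast_eq_zero_iff]
  rw [← hΦ, ← hMpow, map_pow, ← pow_sub_one_mul hp.out.ne_zero, Module.End.mul_apply, hMf, hMconst,
    ZMod.pow_card_sub_one_eq_one hcard']

/-- Dilating a tile by a prime that does not divide its size preserves the tiling property. -/
theorem existsUnique_sub_nsmul_mem {p : ℕ} [Fact p.Prime] {v : ι → V} {T : Set V}
    (hcard : ¬ p ∣ Fintype.card ι) (hT : ∀ x, ∃! a, x - v a ∈ T) (x : V) :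
    ∃! a, x - p • v a ∈ T := by
  classical
  let count (w : ι → V) (x : V) : ℕ := ∑ a, if x - w a ∈ T then 1 else 0
  have hcount (w : ι → V) (x : V) : count w x = 1 ↔ ∃! a, x - w a ∈ T := by
    simp only [count, Finset.sum_boole, Nat.cast_id, Finset.card_eq_one]
    constructor
    · rintro ⟨a, ha⟩
      simp only [Finset.ext_iff, Finset.mem_filter_univ, Finset.mem_singleton] at ha
      exact ⟨a, (ha a).2 rfl, fun b hb => (ha b).1 hb⟩
    · rintro ⟨a, ha, hu⟩
      refine ⟨a, ?_⟩
      ext b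
      simp only [Finset.mem_filter_univ, Finset.mem_singleton]
      exact ⟨hu b, fun h => h ▸ ha⟩
  have hv (x : V) : count v x = 1 := (hcount v x).2 (hT x)
  have hpos (x : V) : 1 ≤ count (fun a => p • v a) x := by
    have h := sum_translates_nsmul_eq_one v hcard (fun y => if y ∈ T then (1 : ZMod p) else 0)
      (fun y => by simpa [count] using congrArg (Nat.cast : ℕ → ZMod p) (hv y)) x
    rw [Nat.one_le_iff_ne_zero]
    intro h0
    have h0' := congrArg (Nat.cast : ℕ → ZMod p) h0
    simp only [count, Nat.cast_sum, Nat.cast_ite, Nat.cast_one, Nat.cast_zero] at h0'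
    exact one_ne_zero (h.symm.trans h0')
  obtain ⟨b⟩ : Nonempty ι := by
    rw [← Fintype.card_pos_iff, Nat.pos_iff_ne_zero]
    exact fun h => hcard (h ▸ dvd_zero p)
  have hsum : ∑ _c : ι, 1 = ∑ c, count (fun a => p • v a) (x + v b - v c) := by
    simp only [count]
    rw [Finset.sum_comm]
    refine Finset.sum_congr rfl fun a _ => ?_
    refine (hv (x + v b - p • v a)).symm.trans ?_
    exact Finset.sum_congr rfl fun c _ => by rw [sub_right_comm]
  have hone := (Finset.sum_eq_sum_iff_of_le fun c _ => hpos (x + v b - v c)).1 hsum b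
    (Finset.mem_univ b)
  rw [add_sub_cancel_right] at hone
  exact (hcount _ x).1 hone.symm

end Tiling

/-- The points of the Lee ball of radius 1 around the origin: the origin and the signed unit
vectors. -/
def leeBall (n : ℕ) : Option (Fin n × ℤˣ) → Fin n → ℤ
  | none => 0
  | some (j, u) => Pi.single j (u : ℤ)

theorem leeBall_injective (n : ℕ) : Function.Injective (leeBall n) := by
  rintro (_ | ⟨j, u⟩) (_ | ⟨k, w⟩) h
  · rfl
  · simpa [leeBall] using (congrFun h k).symm
  · simpa [leeBall] using congrFun h j
  · obtain rfl : j = k := by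
      by_contra hjk
      simpa [leeBall, hjk] using congrFun h j
    have := congrFun h j
    simp only [leeBall, Pi.single_eq_same, Units.val_inj] at this
    rw [this]

theorem sum_abs_leeBall_le_one {n : ℕ} (a : Option (Fin n × ℤˣ)) :
    ∑ i, |leeBall n a i| ≤ 1 := by
  rcases a with _ | ⟨j, u⟩
  · simp [leeBall]
  · rw [Finset.sum_eq_single j]
    · simp [leeBall, Int.isUnit_iff_abs_eq.1 u.isUnit]
    · intro i _ hij
      simp [leeBall, hij]
    · simp

theorem exists_leeBall_eq {n : ℕ} {y : Fin n → ℤ} (hy : ∑ i, |y i| ≤ 1) :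
    ∃ a, leeBall n a = y := by
  by_cases h0 : y = 0
  · exact ⟨none, h0.symm⟩
  obtain ⟨j, hj⟩ := Function.ne_iff.1 h0
  have hj1 : 1 ≤ |y j| := Int.one_le_abs hj
  have hsplit := Finset.add_sum_erase Finset.univ (fun i => |y i|) (Finset.mem_univ j)
  have hrest (i : Fin n) (hi : i ≠ j) : y i = 0 := by
    have := Finset.single_le_sum (f := fun i => |y i|) (fun k _ => abs_nonneg (y k))
      (Finset.mem_erase.2 ⟨hi, Finset.mem_univ i⟩)
    refine abs_eq_zero.1 (le_antisymm ?_ (abs_nonneg _))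
    linarith
  have hnonneg : 0 ≤ ∑ i ∈ Finset.univ.erase j, |y i| :=
    Finset.sum_nonneg fun k _ => abs_nonneg (y k)
  have hunit : IsUnit (y j) := by
    rw [Int.isUnit_iff_abs_eq]
    linarith
  refine ⟨some (j, hunit.unit), ?_⟩
  funext i
  by_cases hi : i = j
  · subst hi; simp [leeBall]
  · simp [leeBall, hi, hrest i hi]

theorem PerfectLeeCode.existsUnique_sub_leeBall_mem {n : ℕ} {T : Set (Fin n → ℤ)}
    (hT : PerfectLeeCode n T) (x : Fin n → ℤ) : ∃! a, x - leeBall n a ∈ T := by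
  obtain ⟨t, ⟨htT, ht⟩, hu⟩ := hT x
  obtain ⟨a, ha⟩ := exists_leeBall_eq (y := x - t) ht
  refine ⟨a, by simpa [ha] using htT, fun b hb => leeBall_injective n ?_⟩
  rw [ha, ← hu _ ⟨hb, by simpa using sum_abs_leeBall_le_one b⟩, sub_sub_cancel]

theorem IsType2111.exists_eq_of_apply_eq_unit {n : ℕ} {W : Fin n → ℤ} (hW : IsType2111 W)
    {i : Fin n} {u : ℤˣ} (hi : W i = u) :
    ∃ j w, W = leeBall n (some (i, u)) - 2 • leeBall n (some (j, w)) := by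
  obtain ⟨j, k, hjk, hj, hk, hrest⟩ := hW
  have hu : |(u : ℤ)| = 1 := Int.isUnit_iff_abs_eq.1 u.isUnit
  obtain rfl : i = k := by
    by_contra hik
    by_cases hij : i = j
    · subst hij; rw [hi] at hj; omega
    · rw [hrest i hij hik] at hi; simp [← hi] at hu
  have hfun (w : ℤˣ) (hw : W j = -2 * (w : ℤ)) :
      W = leeBall n (some (i, u)) - 2 • leeBall n (some (j, w)) := by
    funext l
    by_cases hl : l = j
    · subst hl; simp [leeBall, hjk, hw]
    · by_cases hli : l = i
      · subst hli; simp [leeBall, hl, hi]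
      · simp [leeBall, hl, hli, hrest l hl hli]
  rcases (abs_eq (by norm_num)).1 hj with h | h
  · exact ⟨j, -1, hfun _ (by simp [h])⟩
  · exact ⟨j, 1, hfun _ (by simp [h])⟩

theorem IsType2111.exists_eq_of_apply_eq_two_mul_unit {n : ℕ} {W : Fin n → ℤ}
    (hW : IsType2111 W) {i : Fin n} {u : ℤˣ} (hi : W i = 2 * u) :
    ∃ j w, W = 2 • leeBall n (some (i, u)) - leeBall n (some (j, w)) := by
  obtain ⟨j, k, hjk, hj, hk, hrest⟩ := hW
  have hu : |2 * (u : ℤ)| = 2 := by simp [abs_mul, Int.isUnit_iff_abs_eq.1 u.isUnit]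
  obtain rfl : i = j := by
    by_contra hij
    by_cases hik : i = k
    · subst hik; rw [hi] at hk; omega
    · rw [hrest i hij hik] at hi; simp [← hi] at hu
  have hfun (w : ℤˣ) (hw : W k = -(w : ℤ)) :
      W = 2 • leeBall n (some (i, u)) - leeBall n (some (k, w)) := by
    funext l
    by_cases hl : l = i
    · subst hl; simp [leeBall, hjk, hi]
    · by_cases hlk : l = k
      · subst hlk; simp [leeBall, hl, hw]
      · simp [leeBall, hl, hlk, hrest l hl hlk]
  rcases (abs_eq (by norm_num)).1 hk with h | h
  · exact ⟨k, -1, hfun _ (by simp [h])⟩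
  · exact ⟨k, 1, hfun _ (by simp [h])⟩

/-- For `n ≡ 2 (mod 3)` and each signed coordinate direction `(i, ε)`, there is
exactly one codeword of type [2^1,1^1] whose `i`-th coordinate is `2ε`, and
exactly one whose `i`-th coordinate is `ε`. -/
theorem local_2111 (n : ℕ) (hn : n % 3 = 2) (T : Set (Fin n → ℤ))
    (hT : PerfectLeeCode n T) (h0 : 0 ∈ T) (i : Fin n) (ε : ℤ)
    (hε : ε = 1 ∨ ε = -1) :
    (∃! W, W ∈ T ∧ IsType2111 W ∧ W i = 2 * ε) ∧
    (∃! W, W ∈ T ∧ IsType2111 W ∧ W i = ε) := by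
  obtain ⟨u, rfl⟩ : ∃ u : ℤˣ, (u : ℤ) = ε := Int.isUnit_iff.2 hε
  have htile := hT.existsUnique_sub_leeBall_mem
  have hcard : Fintype.card (Option (Fin n × ℤˣ)) = n * 2 + 1 := by simp
  have htile_two : ∀ x, ∃! a, x - 2 • leeBall n a ∈ T :=
    existsUnique_sub_nsmul_mem (by rw [hcard]; omega) htile
  have htile_three : ∀ x, ∃! a, x - 3 • leeBall n a ∈ T :=
    existsUnique_sub_nsmul_mem (by rw [hcard]; omega) htile
  have hneg (j : Fin n) (w : ℤˣ) : leeBall n (some (j, -w)) = -leeBall n (some (j, w)) := by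
    simp [leeBall, Pi.single_neg]
  have habs (w : ℤˣ) : |(w : ℤ)| = 1 := Int.isUnit_iff_abs_eq.1 w.isUnit
  have hunits (w : ℤˣ) : w = u ∨ w = -u := by
    rcases Int.units_eq_one_or w with rfl | rfl <;>
      rcases Int.units_eq_one_or u with rfl | rfl <;> simp
  have hone (w : ℤˣ) : leeBall n (some (i, w)) ∉ T := fun h => by
    simpa using (htile (leeBall n (some (i, w)))).unique (y₁ := none) (y₂ := some (i, w))
      (by simpa [leeBall] using h) (by simpa using h0)
  have htwo : 2 • leeBall n (some (i, u)) ∉ T := fun h => by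
    have := (htile (leeBall n (some (i, u)))).unique (y₁ := some (i, u)) (y₂ := some (i, -u))
      (by simpa using h0) (by rwa [hneg, sub_neg_eq_add, ← two_nsmul])
    simp at this
  have hthree : 3 • leeBall n (some (i, u)) ∉ T := fun h => by
    simpa using (htile_three (3 • leeBall n (some (i, u)))).unique (y₁ := none)
      (y₂ := some (i, u)) (by simpa [leeBall] using h) (by simpa using h0)
  constructor
  · obtain ⟨a, ha, hu⟩ := htile (2 • leeBall n (some (i, u)))
    refine ⟨2 • leeBall n (some (i, u)) - leeBall n a, ?_, ?_⟩
    · rcases a with _ | ⟨j, w⟩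
      · exact absurd (by simpa [leeBall] using ha) htwo
      have hji : j ≠ i := by
        rintro rfl
        rcases hunits w with rfl | rfl
        · exact hone w (by rwa [two_nsmul, add_sub_cancel_right] at ha)
        · exact hthree (by rwa [hneg, sub_neg_eq_add, ← succ_nsmul] at ha)
      refine ⟨ha, ⟨i, j, hji.symm, ?_, ?_, fun k hki hkj => ?_⟩, ?_⟩
      · simp [leeBall, hji.symm, abs_mul, habs]
      · simp [leeBall, hji, habs]
      · simp [leeBall, hki, hkj]
      · simp [leeBall, hji.symm]
    · rintro W ⟨hWT, hW, hWi⟩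
      obtain ⟨j, w, rfl⟩ := hW.exists_eq_of_apply_eq_two_mul_unit hWi
      rw [← hu _ hWT]
  · obtain ⟨a, ha, hu⟩ := htile_two (leeBall n (some (i, u)))
    refine ⟨leeBall n (some (i, u)) - 2 • leeBall n a, ?_, ?_⟩
    · rcases a with _ | ⟨j, w⟩
      · exact absurd (by simpa [leeBall] using ha) (hone u)
      have hji : j ≠ i := by
        rintro rfl
        rcases hunits w with rfl | rfl
        · exact hone (-w) (by rwa [two_nsmul, sub_add_cancel_left, ← hneg] at ha)
        · exact hthree (by rwa [hneg, smul_neg, sub_neg_eq_add, ← succ_nsmul'] at ha)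
      refine ⟨ha, ⟨j, i, hji, ?_, ?_, fun k hkj hki => ?_⟩, ?_⟩
      · simp [leeBall, hji, abs_mul, habs]
      · simp [leeBall, hji.symm, habs]
      · simp [leeBall, hki, hkj]
      · simp [leeBall, hji.symm]
    · rintro W ⟨hWT, hW, hWi⟩
      obtain ⟨j, w, rfl⟩ := hW.exists_eq_of_apply_eq_unit hWi
      rw [← hu _ hWT]
end

section
/- If 11 divides q, then there exists a perfect 1-error-correcting Lee code of block size 5 over ℤ/q, i.e. a subset M ⊆ (ℤ/q)^5 such that every element of (ℤ/q)^5 is at Lee distance at most 1 from exactly one element of M. -/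
/-- The Lee weight of `a ∈ ℤ/q`: `min(val a, q - val a)`. -/
def leeWeight (q : ℕ) (a : ZMod q) : ℕ := min a.val (q - a.val)

lemma leeWeight_eq_zero {q : ℕ} [NeZero q] {a : ZMod q} : leeWeight q a = 0 ↔ a = 0 := by
  have h := ZMod.val_lt a
  rw [← ZMod.val_eq_zero, leeWeight]
  omega

lemma leeWeight_le_one {q : ℕ} [NeZero q] {a : ZMod q} :
    leeWeight q a ≤ 1 ↔ ∃ s : SignType, a = s := by
  constructor
  · intro h
    have hlt := ZMod.val_lt a
    have hcast := ZMod.natCast_zmod_val a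
    have hcases : a.val = 0 ∨ a.val = 1 ∨ a.val + 1 = q := by
      rw [leeWeight] at h
      omega
    rcases hcases with h0 | h1 | h2
    · exact ⟨0, by simpa [h0] using hcast.symm⟩
    · exact ⟨1, by simpa [h1] using hcast.symm⟩
    · refine ⟨-1, ?_⟩
      have h3 : ((a.val + 1 : ℕ) : ZMod q) = 0 := by rw [h2, ZMod.natCast_self]
      rw [Nat.cast_add, hcast, Nat.cast_one] at h3
      simpa using eq_neg_of_add_eq_zero_left h3
  · rintro ⟨s, rfl⟩
    have hone : (1 : ZMod q).val ≤ 1 := by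
      rw [ZMod.val_one_eq_one_mod]
      exact Nat.mod_le 1 q
    rcases s with _ | _ | _
    · simp [leeWeight]
    · have := ZMod.neg_val (1 : ZMod q)
      simp only [leeWeight, SignType.neg_eq_neg_one, SignType.coe_neg_one]
      split_ifs at this <;> omega
    · simp only [leeWeight, SignType.pos_eq_one, SignType.coe_one]
      omega

/-- The Lee ball of radius one consists of the vectors `s • eᵢ` with `s ∈ {-1, 0, 1}`. -/
lemma sum_leeWeight_le_one {q : ℕ} [NeZero q] {ι : Type*} [Fintype ι] [DecidableEq ι] [Nonempty ι]
    {e : ι → ZMod q} :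
    ∑ i, leeWeight q (e i) ≤ 1 ↔ ∃ (i : ι) (s : SignType), e = Pi.single i (s : ZMod q) := by
  constructor
  · intro h
    by_cases he : e = 0
    · exact ⟨Classical.arbitrary ι, 0, by simp [he]⟩
    · obtain ⟨i, hi⟩ := Function.ne_iff.mp he
      have hpos : leeWeight q (e i) ≠ 0 := fun h0 => hi (leeWeight_eq_zero.mp h0)
      have hsplit := Finset.add_sum_erase Finset.univ (fun j => leeWeight q (e j))
        (Finset.mem_univ i)
      have hrest : ∑ j ∈ Finset.univ.erase i, leeWeight q (e j) = 0 := by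
        omega
      obtain ⟨s, hs⟩ := leeWeight_le_one.mp (show leeWeight q (e i) ≤ 1 by omega)
      refine ⟨i, s, funext fun j => ?_⟩
      by_cases hj : j = i
      · subst hj
        simpa using hs
      · rw [Pi.single_eq_of_ne hj]
        exact leeWeight_eq_zero.mp (Finset.sum_eq_zero_iff.mp hrest j (by simp [hj]))
  · rintro ⟨i, s, rfl⟩
    rw [Finset.sum_eq_single i]
    · simpa using leeWeight_le_one.mpr ⟨s, rfl⟩
    · intro j _ hj
      rw [Pi.single_eq_of_ne hj]
      exact leeWeight_eq_zero.mpr rfl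
    · simp

/-- The coefficients of the parity check. -/
def parityCoeff : Fin 5 → ZMod 11 := ![1, 9, 4, 3, 5]

lemma exists_parityCoeff_mul_sign (a : ZMod 11) :
    ∃ (i : Fin 5) (s : SignType), parityCoeff i * (s : ZMod 11) = a := by
  revert a
  decide

lemma parityCoeff_mul_sign_inj (i j : Fin 5) (s t : SignType)
    (h : parityCoeff i * (s : ZMod 11) = parityCoeff j * (t : ZMod 11)) :
    s = t ∧ (i = j ∨ s = 0) := by
  revert i j s t
  decide

/-- The parity check `x ↦ x₁ + 9x₂ + 4x₃ + 3x₄ + 5x₅` modulo `11`. -/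
def syndrome {q : ℕ} (hdvd : 11 ∣ q) : (Fin 5 → ZMod q) →+ ZMod 11 where
  toFun x := ∑ i, parityCoeff i * ZMod.castHom hdvd (ZMod 11) (x i)
  map_zero' := by simp
  map_add' x y := by simp only [Pi.add_apply, map_add, mul_add, Finset.sum_add_distrib]

lemma syndrome_single {q : ℕ} (hdvd : 11 ∣ q) (i : Fin 5) (s : SignType) :
    syndrome hdvd (Pi.single i (s : ZMod q)) = parityCoeff i * (s : ZMod 11) := by
  change ∑ j, parityCoeff j * ZMod.castHom hdvd (ZMod 11)
    ((Pi.single i (s : ZMod q) : Fin 5 → ZMod q) j) = _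
  rw [Finset.sum_eq_single i]
  · rw [Pi.single_eq_same]
    congr 1
    rcases s with _ | _ | _ <;>
      simp only [SignType.zero_eq_zero, SignType.neg_eq_neg_one, SignType.pos_eq_one,
        SignType.coe_zero, SignType.coe_one, SignType.coe_neg_one, map_zero, map_one, map_neg]
  · intro j _ hj
    rw [Pi.single_eq_of_ne hj, map_zero, mul_zero]
  · simp

/-- If `11 ∣ q` then there exists a perfect 1-error-correcting Lee code of block
size 5 over `ℤ/q`. -/
theorem exists_PL5q1 (q : ℕ) (hq : 0 < q) (hdvd : 11 ∣ q) :
    ∃ M : Set (Fin 5 → ZMod q), ∀ x : Fin 5 → ZMod q,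
      ∃! t, t ∈ M ∧ ∑ i, leeWeight q (x i - t i) ≤ 1 := by
  have : NeZero q := ⟨hq.ne'⟩
  refine ⟨{t | syndrome hdvd t = 0}, fun x => ?_⟩
  obtain ⟨i, s, his⟩ := exists_parityCoeff_mul_sign (syndrome hdvd x)
  refine ⟨x - Pi.single i (s : ZMod q), ⟨?_, ?_⟩, ?_⟩
  · rw [Set.mem_ofPred_eq, map_sub, syndrome_single, his, sub_self]
  · refine sum_leeWeight_le_one.mpr ⟨i, s, funext fun j => ?_⟩
    rw [Pi.sub_apply, sub_sub_cancel]
  · rintro t ⟨ht, hball⟩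
    obtain ⟨j, r, hjr⟩ := sum_leeWeight_le_one (e := x - t).mp hball
    have hsyn := congrArg (syndrome hdvd) hjr
    rw [map_sub, Set.mem_ofPred_eq.mp ht, sub_zero, syndrome_single, ← his] at hsyn
    obtain ⟨rfl, rfl | rfl⟩ := parityCoeff_mul_sign_inj i j s r hsyn
    · rw [← hjr, sub_sub_cancel]
    · simpa [sub_eq_zero, eq_comm] using hjr
end
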